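/- arXiv:1810.11526 — 2 statements merged into one kernel-verified Lean document; each statement's English description precedes it below -/
import Mathlib

section
/- Let T = (V, E) be a finite tree and let X = {X_1, ..., X_m} ⊆ V be a set of observed nodes such that every vertex of V of degree at most two belongs to X. Let δ be a pseudometric on X, writing δ_pq = δ(X_p, X_q). Then δ is T-induced if and only if the following two conditions hold: (1) for any four distinct indices p, q, r, s ∈ {1,...,m} with ph_T(X_p, X_q) ∩ ph_T(X_r, X_s) = ∅, one has δ_pq + δ_rs ≤ δ_pr + δ_qs and δ_pr + δ_qs = δ_ps + δ_qr; and (2) for any three distinct indices p, q, r ∈ {1,...,m} with ph_T(X_p, X_r) = ph_T(X_p, X_q) ∪ ph_T(X_q, X_r), one has δ_pq + δ_qr = δ_pr. -/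
open SimpleGraph Finset

/-- The unique path between two vertices of a tree. -/
noncomputable def treePath {V : Type*} {G : SimpleGraph V} (hG : G.IsTree) (u v : V) :
    G.Walk u v :=
  (hG.existsUnique_path u v).choose

/-- `ph hG u v` is the set of edges lying on the unique path connecting `u` and `v` in the
tree `G`. -/
noncomputable def ph {V : Type*} [DecidableEq V] {G : SimpleGraph V} (hG : G.IsTree)
    (u v : V) : Finset (Sym2 V) :=
  (treePath hG u v).edges.toFinset

/-- The pseudometric induced by a tree with weight function `w` on its edges. -/
noncomputable def deltaW {V : Type*} [DecidableEq V] {G : SimpleGraph V} (hG : G.IsTree)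
    (w : Sym2 V → ℝ) (u v : V) : ℝ :=
  ∑ e ∈ ph hG u v, w e

section TreePaths

variable {V : Type*} [DecidableEq V] {G : SimpleGraph V} (hG : G.IsTree)

omit [DecidableEq V] in
theorem treePath_isPath (u v : V) : (treePath hG u v).IsPath :=
  (hG.existsUnique_path u v).choose_spec.1

omit [DecidableEq V] in
theorem eq_treePath {u v : V} {p : G.Walk u v} (hp : p.IsPath) : p = treePath hG u v :=
  (hG.existsUnique_path u v).choose_spec.2 p hp

theorem mem_ph_iff {u v : V} {e : Sym2 V} : e ∈ ph hG u v ↔ e ∈ (treePath hG u v).edges := by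
  simp [ph]

theorem mem_ph_of_isPath {u v : V} {e : Sym2 V} {p : G.Walk u v} (hp : p.IsPath) :
    e ∈ ph hG u v ↔ e ∈ p.edges := by
  rw [mem_ph_iff, ← eq_treePath hG hp]

theorem ph_self (u : V) : ph hG u u = ∅ := by
  ext e
  rw [mem_ph_of_isPath hG Walk.IsPath.nil]
  simp

theorem ph_comm (u v : V) : ph hG u v = ph hG v u := by
  ext e
  rw [mem_ph_iff, mem_ph_of_isPath hG (treePath_isPath hG u v).reverse]
  simp

theorem ph_of_adj {u v : V} (h : G.Adj u v) : ph hG u v = {s(u, v)} := by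
  have hp : (Walk.cons h Walk.nil).IsPath := by simp [h.ne]
  ext e
  rw [mem_ph_of_isPath hG hp]
  simp

theorem mem_ph_iff_of_adj {u v w : V} (h : G.Adj u v) (e : Sym2 V) :
    e ∈ ph hG u w ↔ (e = s(u, v) ↔ e ∉ ph hG v w) := by
  by_cases hu : u ∈ (treePath hG v w).support
  · have h1 := (treePath_isPath hG v w).takeUntil hu
    have h2 := (treePath_isPath hG v w).dropUntil hu
    have hs := (treePath hG v w).take_spec hu
    have hT := (treePath_isPath hG v w).isTrail.edges_nodup
    rw [← hs, Walk.edges_append, List.nodup_append] at hT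
    have h3 : e ∈ ph hG v w ↔ e ∈ ph hG v u ∨ e ∈ ph hG u w := by
      rw [mem_ph_of_isPath hG h1, mem_ph_of_isPath hG h2, mem_ph_iff]
      rw [← List.mem_append, ← Walk.edges_append, hs]
    have h4 : e ∈ ph hG v u → e ∉ ph hG u w := by
      rw [mem_ph_of_isPath hG h1, mem_ph_of_isPath hG h2]
      intro a b
      exact hT.2.2 _ a _ b rfl
    rw [ph_of_adj hG h.symm, Finset.mem_singleton, Sym2.eq_swap] at h3 h4
    tauto
  · have hp : (Walk.cons h (treePath hG v w)).IsPath :=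
      (Walk.cons_isPath_iff _ _).2 ⟨treePath_isPath hG v w, hu⟩
    have : s(u, v) ∉ ph hG v w := by
      rw [mem_ph_iff]
      exact fun hh => hu (Walk.fst_mem_support_of_mem_edges _ hh)
    rw [mem_ph_of_isPath hG hp, Walk.edges_cons, List.mem_cons, ← mem_ph_iff]
    by_cases he : e = s(u, v)
    · subst he; tauto
    · tauto

theorem mem_ph_trans (u v w : V) (e : Sym2 V) :
    e ∈ ph hG u w ↔ (e ∈ ph hG u v ↔ e ∉ ph hG v w) := by
  induction treePath hG u v with
  | nil => simp [ph_self]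
  | cons h p ih =>
    rw [mem_ph_iff_of_adj hG h, ih, mem_ph_iff_of_adj hG h (w := _)]
    tauto

theorem exists_adj_of_ne {u x : V} (h : u ≠ x) :
    ∃ t, G.Adj u t ∧ s(u, t) ∈ ph hG u x := by
  have hn : ¬ (treePath hG u x).Nil := Walk.not_nil_of_ne h
  refine ⟨(treePath hG u x).snd, (treePath hG u x).adj_snd hn, ?_⟩
  rw [mem_ph_iff]
  exact Walk.mk_start_snd_mem_edges hn

theorem eq_of_mem_ph {u x t : V} (h : s(u, t) ∈ ph hG u x) :
    t = (treePath hG u x).snd := by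
  rw [mem_ph_iff] at h
  exact (treePath_isPath hG u x).eq_snd_of_mem_edges h

theorem snd_treePath_of_mem_support {u x z : V} (hz : z ∈ (treePath hG u x).support)
    (hzu : u ≠ z) : (treePath hG u x).snd = (treePath hG u z).snd := by
  rw [← eq_treePath hG ((treePath_isPath hG u x).takeUntil hz)]
  refine (Walk.getVert_takeUntil hz ?_).symm
  exact Nat.one_le_iff_ne_zero.2 fun h => hzu (Walk.eq_of_length_eq_zero h)

theorem snd_treePath_eq_of_not_disjoint {u x y : V} (h : ¬ Disjoint (ph hG u x) (ph hG u y)) :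
    u ≠ x ∧ u ≠ y ∧ (treePath hG u x).snd = (treePath hG u y).snd := by
  rw [Finset.not_disjoint_iff] at h
  obtain ⟨e, hx, hy⟩ := h
  refine ⟨?_, ?_, ?_⟩
  · rintro rfl
    simp [ph_self] at hx
  · rintro rfl
    simp [ph_self] at hy
  rw [mem_ph_iff] at hx hy
  induction e using Sym2.ind with
  | _ a b =>
    have hab := ((treePath hG u x).adj_of_mem_edges hx).ne
    by_cases hua : u = a
    · have hub : u ≠ b := hua ▸ hab
      rw [snd_treePath_of_mem_support hG (Walk.snd_mem_support_of_mem_edges _ hx) hub,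
        snd_treePath_of_mem_support hG (Walk.snd_mem_support_of_mem_edges _ hy) hub]
    · rw [snd_treePath_of_mem_support hG (Walk.fst_mem_support_of_mem_edges _ hx) hua,
        snd_treePath_of_mem_support hG (Walk.fst_mem_support_of_mem_edges _ hy) hua]

theorem not_disjoint_ph_iff {u x y : V} : ¬ Disjoint (ph hG u x) (ph hG u y) ↔
    u ≠ x ∧ u ≠ y ∧ (treePath hG u x).snd = (treePath hG u y).snd := by
  refine ⟨snd_treePath_eq_of_not_disjoint hG, fun ⟨hx, hy, h⟩ => ?_⟩
  rw [Finset.not_disjoint_iff]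
  obtain ⟨t, -, ht⟩ := exists_adj_of_ne hG hx
  obtain ⟨t', -, ht'⟩ := exists_adj_of_ne hG hy
  refine ⟨_, ht, ?_⟩
  rwa [eq_of_mem_ph hG ht, h, ← eq_of_mem_ph hG ht']

theorem disjoint_ph_right_of_not_disjoint {u x y z : V}
    (h : ¬ Disjoint (ph hG u x) (ph hG u y)) (h' : Disjoint (ph hG u x) (ph hG u z)) :
    Disjoint (ph hG u y) (ph hG u z) := by
  by_contra hc
  rw [not_disjoint_ph_iff] at h hc
  exact (not_disjoint_ph_iff hG).2 ⟨h.1, hc.2.1, h.2.2.trans hc.2.2⟩ h'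

theorem ph_subset_union (u p q : V) : ph hG p q ⊆ ph hG u p ∪ ph hG u q := by
  intro e he
  rw [mem_ph_trans hG p u q, ph_comm hG p u] at he
  rw [Finset.mem_union]
  tauto

theorem disjoint_ph_of_disjoint {u p q : V} {s : Finset (Sym2 V)} (hp : Disjoint (ph hG u p) s)
    (hq : Disjoint (ph hG u q) s) : Disjoint (ph hG p q) s :=
  (Finset.disjoint_union_left.2 ⟨hp, hq⟩).mono_left (ph_subset_union hG u p q)

theorem disjoint_ph_across {u v p r : V} (huv : u ≠ v)
    (hp : Disjoint (ph hG u v) (ph hG u p)) (hr : Disjoint (ph hG v u) (ph hG v r)) :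
    Disjoint (ph hG u p) (ph hG v r) := by
  have hsub : ∀ e, e ∈ ph hG u v ∨ e ∈ ph hG v r → e ∈ ph hG u r := by
    intro e he
    rw [mem_ph_trans hG u v r]
    rw [ph_comm hG v u, Finset.disjoint_left] at hr
    have := @hr e
    tauto
  have hnd : ¬ Disjoint (ph hG u v) (ph hG u r) := by
    obtain ⟨t, -, ht⟩ := exists_adj_of_ne hG huv
    exact Finset.not_disjoint_iff.2 ⟨_, ht, hsub _ (Or.inl ht)⟩
  exact ((disjoint_ph_right_of_not_disjoint hG hnd hp).mono_left fun e he => hsub e (Or.inr he)).symm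

section Observed

variable [Fintype V] [DecidableRel G.Adj] {ι : Type*} {X : ι → V}

theorem exists_mem_range_of_adj (hdeg : ∀ v : V, G.degree v ≤ 2 → v ∈ Set.range X)
    {v t : V} (h : G.Adj v t) : ∃ i, s(v, t) ∈ ph hG v (X i) := by
  obtain ⟨z, hz, hmax⟩ := Finset.exists_max_image
    (Finset.univ.filter fun z => s(v, t) ∈ ph hG v z) (fun z => (ph hG v z).card)
    ⟨t, by simp [ph_of_adj hG h]⟩
  simp only [Finset.mem_filter, Finset.mem_univ, true_and] at hz hmax
  by_cases hzX : z ∈ Set.range X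
  · obtain ⟨i, rfl⟩ := hzX
    exact ⟨i, hz⟩
  have hcard : 2 < (G.neighborFinset z).card := by
    rw [G.card_neighborFinset_eq_degree]
    exact lt_of_not_ge fun hc => hzX (hdeg z hc)
  obtain ⟨y, hy, hne⟩ := Finset.exists_mem_ne (lt_trans one_lt_two hcard) (treePath hG z v).snd
  rw [mem_neighborFinset] at hy
  have hnot : s(z, y) ∉ ph hG v z := fun hc =>
    hne (eq_of_mem_ph hG (ph_comm hG v z ▸ hc))
  have hins : ph hG v y = insert s(z, y) (ph hG v z) := by
    ext e
    rw [mem_ph_trans hG v z y, ph_of_adj hG hy, Finset.mem_singleton, Finset.mem_insert]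
    by_cases he : e = s(z, y)
    · subst he
      tauto
    · tauto
  have := hmax y (hins ▸ Finset.mem_insert_of_mem hz)
  rw [hins, Finset.card_insert_of_notMem hnot] at this
  omega

theorem exists_disjoint_ph (hdeg : ∀ v : V, G.degree v ≤ 2 → v ∈ Set.range X) (v x y : V) :
    ∃ i, Disjoint (ph hG v (X i)) (ph hG v x) ∧ Disjoint (ph hG v (X i)) (ph hG v y) := by
  by_cases hv : v ∈ Set.range X
  · obtain ⟨i, rfl⟩ := hv
    exact ⟨i, by simp [ph_self]⟩
  have hcard : 2 < (G.neighborFinset v).card := by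
    rw [G.card_neighborFinset_eq_degree]
    exact lt_of_not_ge fun hc => hv (hdeg v hc)
  obtain ⟨t, ht, hnot⟩ := Finset.exists_mem_notMem_of_card_lt_card
    (lt_of_le_of_lt (Finset.card_le_two (a := (treePath hG v x).snd)
      (b := (treePath hG v y).snd)) hcard)
  rw [mem_neighborFinset] at ht
  obtain ⟨i, hi⟩ := exists_mem_range_of_adj hG hdeg ht
  have := eq_of_mem_ph hG hi
  simp only [Finset.mem_insert, Finset.mem_singleton, not_or] at hnot
  refine ⟨i, ?_, ?_⟩
  · by_contra hc
    exact hnot.1 (this.trans ((not_disjoint_ph_iff hG).1 hc).2.2)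
  · by_contra hc
    exact hnot.2 (this.trans ((not_disjoint_ph_iff hG).1 hc).2.2)

end Observed

theorem ph_subset_edgeSet {u v : V} {e : Sym2 V} (h : e ∈ ph hG u v) : e ∈ G.edgeSet :=
  Walk.edges_subset_edgeSet _ ((mem_ph_iff hG).1 h)

theorem deltaW_four_point {w : Sym2 V → ℝ} (hw : ∀ e ∈ G.edgeSet, 0 ≤ w e) {p q r s : V}
    (h : Disjoint (ph hG p q) (ph hG r s)) :
    deltaW hG w p q + deltaW hG w r s ≤ deltaW hG w p r + deltaW hG w q s ∧
      deltaW hG w p r + deltaW hG w q s = deltaW hG w p s + deltaW hG w q r := by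
  set U := ph hG p q ∪ ph hG p r ∪ ph hG p s with hU
  have hsum : ∀ a b, ph hG a b ⊆ U →
      deltaW hG w a b = ∑ e ∈ U, if e ∈ ph hG a b then w e else 0 := by
    intro a b hab
    rw [deltaW, ← Finset.sum_filter, Finset.filter_mem_eq_inter, Finset.inter_eq_right.2 hab]
  have hpq : ph hG p q ⊆ U := fun e he => by simp [hU, he]
  have hpr : ph hG p r ⊆ U := fun e he => by simp [hU, he]
  have hps : ph hG p s ⊆ U := fun e he => by simp [hU, he]
  have hsub : ∀ {a b}, ph hG p a ⊆ U → ph hG p b ⊆ U → ph hG a b ⊆ U := fun ha hb =>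
    (ph_subset_union hG p _ _).trans (Finset.union_subset ha hb)
  have hmem : ∀ a b e, e ∈ ph hG a b ↔ (e ∈ ph hG p a ↔ e ∉ ph hG p b) := by
    intro a b e
    rw [mem_ph_trans hG a p b, ph_comm hG a p]
  rw [hsum p q hpq, hsum p r hpr, hsum p s hps, hsum r s (hsub hpr hps),
    hsum q s (hsub hpq hps), hsum q r (hsub hpq hpr)]
  simp only [← Finset.sum_add_distrib]
  have hd : ∀ e, e ∈ ph hG p q → e ∉ ph hG r s := fun e he => Finset.disjoint_left.1 h he
  simp only [hmem r s] at hd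
  simp only [hmem r s, hmem q s, hmem q r]
  constructor
  · refine Finset.sum_le_sum fun e he => ?_
    have hwe : 0 ≤ w e := by
      simp only [hU, Finset.mem_union] at he
      obtain (he | he) | he := he <;> exact hw e (ph_subset_edgeSet hG he)
    have hde := hd e
    by_cases h1 : e ∈ ph hG p q <;> by_cases h2 : e ∈ ph hG p r <;>
      by_cases h3 : e ∈ ph hG p s <;>
        simp [h1, h2, h3] at hde ⊢ <;> linarith
  · refine Finset.sum_congr rfl fun e _ => ?_
    have hde := hd e
    by_cases h1 : e ∈ ph hG p q <;> by_cases h2 : e ∈ ph hG p r <;>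
      by_cases h3 : e ∈ ph hG p s <;>
        simp [h1, h2, h3] at hde ⊢

theorem deltaW_add {w : Sym2 V → ℝ} {p q r : V} (h : ph hG p r = ph hG p q ∪ ph hG q r) :
    deltaW hG w p q + deltaW hG w q r = deltaW hG w p r := by
  have hd : Disjoint (ph hG p q) (ph hG q r) := by
    refine Finset.disjoint_left.2 fun e he he' => ?_
    have h1 := mem_ph_trans hG p q r e
    have h2 : e ∈ ph hG p r := h ▸ Finset.mem_union_left _ he
    tauto
  rw [deltaW, deltaW, deltaW, h, Finset.sum_union hd]

end TreePaths

section Weights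

variable {V : Type*} [DecidableEq V] {G : SimpleGraph V} (hG : G.IsTree)
  {ι : Type*} (X : ι → V) (δ : ι → ι → ℝ)

/-- The four-point condition, for all quadruples of indices, along disjoint paths. -/
def FourPoint : Prop :=
  ∀ p q r s, Disjoint (ph hG (X p) (X q)) (ph hG (X r) (X s)) →
    δ p q + δ r s ≤ δ p r + δ q s ∧ δ p r + δ q s = δ p s + δ q r

/-- The observed nodes `X p` and `X q` are reached from `u` along edge-disjoint paths that
avoid the path to `v`. -/
def Fork (u v : V) (p q : ι) : Prop :=
  Disjoint (ph hG u v) (ph hG u (X p)) ∧ Disjoint (ph hG u v) (ph hG u (X q)) ∧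
    Disjoint (ph hG u (X p)) (ph hG u (X q))

/-- Twice the weight assigned by `δ` to the edge separating the pairs `p, q` and `r, s`. -/
def splitWeight (p q r s : ι) : ℝ := δ p r + δ q s - δ p q - δ r s

/-- `c` is a weight read off from forks at the two ends of the edge `e`. -/
def IsForkWeight (e : Sym2 V) (c : ℝ) : Prop :=
  ∃ u v p q r s, G.Adj u v ∧ e = s(u, v) ∧ Fork hG X u v p q ∧ Fork hG X v u r s ∧
    c = splitWeight δ p q r s / 2

open scoped Classical in
/-- The edge weights recovered from `δ`. -/
noncomputable def forkWeight (e : Sym2 V) : ℝ :=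
  if h : ∃ c, IsForkWeight hG X δ e c then h.choose else 0

variable {hG X δ}

theorem Fork.symm {u v : V} {p q : ι} (h : Fork hG X u v p q) : Fork hG X u v q p :=
  ⟨h.2.1, h.1, h.2.2.symm⟩

theorem Fork.disjoint_ph {u v : V} {p q r s : ι} (huv : u ≠ v) (h : Fork hG X u v p q)
    (h' : Fork hG X v u r s) : Disjoint (ph hG (X p) (X q)) (ph hG (X r) (X s)) := by
  have hh := fun {a b : V} => disjoint_ph_across hG (p := a) (r := b) huv
  refine disjoint_ph_of_disjoint hG (u := u) (Disjoint.symm ?_) (Disjoint.symm ?_)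
  · exact disjoint_ph_of_disjoint hG (u := v) (hh h.1 h'.1).symm (hh h.1 h'.2.1).symm
  · exact disjoint_ph_of_disjoint hG (u := v) (hh h.2.1 h'.1).symm (hh h.2.1 h'.2.1).symm

section Symm

variable (hsymm : ∀ p q, δ p q = δ q p) (hδ : FourPoint hG X δ)
include hsymm hδ

theorem splitWeight_swap {u v : V} {p q r s : ι} (huv : u ≠ v) (h : Fork hG X u v p q)
    (h' : Fork hG X v u r s) : splitWeight δ p q r s = splitWeight δ q p r s := by
  have := (hδ p q r s (h.disjoint_ph huv h')).2
  have := hsymm p q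
  simp only [splitWeight]
  linarith

theorem splitWeight_congr_fst {u v : V} {p p' q r s : ι} (huv : u ≠ v) (h : Fork hG X u v p q)
    (h₁ : Fork hG X u v p' q) (h' : Fork hG X v u r s) :
    splitWeight δ p q r s = splitWeight δ p' q r s := by
  have hd : Disjoint (ph hG (X p) (X p')) (ph hG (X q) (X r)) := by
    have aux : ∀ a, Fork hG X u v a q → Disjoint (ph hG (X q) (X r)) (ph hG u (X a)) := by
      intro a ha
      refine disjoint_ph_of_disjoint hG ha.2.2.symm ?_
      refine Finset.disjoint_left.2 fun e he => ?_
      rw [mem_ph_trans hG u v] at he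
      have h1 : e ∈ _ → e ∉ _ := fun h => Finset.disjoint_left.1 ha.1 h
      have h2 : e ∈ _ → e ∉ _ := fun h =>
        Finset.disjoint_right.1 (disjoint_ph_across hG huv ha.1 h'.1) h
      tauto
    exact disjoint_ph_of_disjoint hG (aux p h).symm (aux p' h₁).symm
  have := (hδ _ _ _ _ hd).2
  have := hsymm p' q
  simp only [splitWeight]
  linarith

theorem splitWeight_congr_left {u v : V} {p p' q q' r s : ι} (huv : u ≠ v)
    (h : Fork hG X u v p q) (h₁ : Fork hG X u v p' q') (h' : Fork hG X v u r s) :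
    splitWeight δ p q r s = splitWeight δ p' q' r s := by
  have aux : ∀ {a b c d}, Fork hG X u v a b → Fork hG X u v c d →
      Disjoint (ph hG u (X c)) (ph hG u (X b)) →
      splitWeight δ a b r s = splitWeight δ c d r s := by
    intro a b c d hab hcd hd
    have hcb : Fork hG X u v c b := ⟨hcd.1, hab.2.1, hd⟩
    rw [splitWeight_congr_fst hsymm hδ huv hab hcb h', splitWeight_swap hsymm hδ huv hcb h',
      splitWeight_congr_fst hsymm hδ huv hcb.symm hcd.symm h',
      splitWeight_swap hsymm hδ huv hcd.symm h']
  by_cases hd : Disjoint (ph hG u (X p')) (ph hG u (X q))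
  · exact aux h h₁ hd
  · rw [splitWeight_swap hsymm hδ huv h h']
    refine aux h.symm h₁ (disjoint_ph_right_of_not_disjoint hG (fun hc => hd hc.symm) h.2.2.symm)

omit hδ in
theorem splitWeight_comm (p q r s : ι) : splitWeight δ p q r s = splitWeight δ r s p q := by
  simp only [splitWeight]
  rw [hsymm p r, hsymm q s]
  ring

theorem splitWeight_congr {u v : V} {p p' q q' r r' s s' : ι} (huv : u ≠ v)
    (h : Fork hG X u v p q) (h₁ : Fork hG X u v p' q') (h' : Fork hG X v u r s)
    (h₁' : Fork hG X v u r' s') :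
    splitWeight δ p q r s = splitWeight δ p' q' r' s' := by
  rw [splitWeight_congr_left hsymm hδ huv h h₁ h', splitWeight_comm hsymm,
    splitWeight_congr_left hsymm hδ huv.symm h' h₁' h₁, splitWeight_comm hsymm]

theorem forkWeight_eq {u v : V} {p q r s : ι} (huv : G.Adj u v) (h : Fork hG X u v p q)
    (h' : Fork hG X v u r s) : forkWeight hG X δ s(u, v) = splitWeight δ p q r s / 2 := by
  have hex : ∃ c, IsForkWeight hG X δ s(u, v) c := ⟨_, u, v, p, q, r, s, huv, rfl, h, h', rfl⟩
  rw [forkWeight, dif_pos hex]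
  obtain ⟨u', v', p', q', r', s', -, he, h₁, h₁', hc⟩ := hex.choose_spec
  rw [hc]
  rw [Sym2.eq_iff] at he
  obtain ⟨rfl, rfl⟩ | ⟨rfl, rfl⟩ := he
  · rw [splitWeight_congr hsymm hδ huv.ne h h₁ h' h₁']
  · rw [splitWeight_congr hsymm hδ huv.ne h h₁' h' h₁, splitWeight_comm hsymm]

omit hsymm in
theorem forkWeight_nonneg (e : Sym2 V) : 0 ≤ forkWeight hG X δ e := by
  rw [forkWeight]
  split_ifs with hex
  · obtain ⟨u, v, p, q, r, s, huv, -, h, h', hc⟩ := hex.choose_spec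
    rw [hc, splitWeight]
    have := (hδ p q r s (h.disjoint_ph huv.ne h')).1
    linarith
  · exact le_rfl

theorem sum_forkWeight_ph [Fintype V] [DecidableRel G.Adj]
    (hdeg : ∀ v : V, G.degree v ≤ 2 → v ∈ Set.range X) (hrefl : ∀ p, δ p p = 0) (x y : ι)
    (n : ℕ) : ∀ (v : V) (z : ι), (ph hG v (X x)).card = n →
      Disjoint (ph hG v (X x)) (ph hG v (X y)) → Disjoint (ph hG v (X z)) (ph hG v (X x)) →
      Disjoint (ph hG v (X z)) (ph hG v (X y)) →
      ∑ e ∈ ph hG v (X x), forkWeight hG X δ e = (δ x z - δ y z + δ x y) / 2 := by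
  induction n with
  | zero =>
    intro v z hn hxy hzx hzy
    have hv : v = X x := by
      by_contra hne
      obtain ⟨t, -, ht⟩ := exists_adj_of_ne hG hne
      rw [Finset.card_eq_zero.1 hn] at ht
      simp at ht
    subst hv
    have := (hδ x z x y hzy).2
    rw [ph_self, Finset.sum_empty]
    have := hsymm z y
    have := hsymm z x
    have := hrefl x
    linarith
  | succ n ih =>
    intro v z hn hxy hzx hzy
    have hv : v ≠ X x := by
      rintro rfl
      simp [ph_self] at hn
    obtain ⟨t, hvt, ht⟩ := exists_adj_of_ne hG hv
    have hty : s(v, t) ∉ ph hG v (X y) := Finset.disjoint_left.1 hxy ht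
    have hx : ph hG v (X x) = insert s(v, t) (ph hG t (X x)) ∧ s(v, t) ∉ ph hG t (X x) := by
      have h1 := mem_ph_trans hG v t (X x)
      simp only [ph_of_adj hG hvt, Finset.mem_singleton] at h1
      have h2 := (h1 _).1 ht
      simp only [true_iff] at h2
      refine ⟨?_, h2⟩
      ext e
      rw [h1 e, Finset.mem_insert]
      by_cases he : e = s(v, t)
      · subst he
        tauto
      · tauto
    have hy : ph hG t (X y) = insert s(v, t) (ph hG v (X y)) := by
      ext e
      rw [mem_ph_trans hG t v, ph_comm hG t v, ph_of_adj hG hvt, Finset.mem_insert,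
        Finset.mem_singleton]
      by_cases he : e = s(v, t)
      · subst he
        tauto
      · tauto
    rw [hx.1, Finset.card_insert_of_notMem hx.2] at hn
    have hxy' : Disjoint (ph hG t (X x)) (ph hG t (X y)) := by
      rw [hy, Finset.disjoint_insert_right]
      refine ⟨hx.2, hxy.mono_left ?_⟩
      rw [hx.1]
      exact Finset.subset_insert _ _
    obtain ⟨z', hzx', hzy'⟩ := exists_disjoint_ph hG hdeg t (X x) (X y)
    have hsum := ih t z' (by omega) hxy' hzx' hzy'
    have hvsub : ph hG v t ⊆ ph hG v (X x) := by
      rw [ph_of_adj hG hvt]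
      simpa using ht
    have htsub : ph hG t v ⊆ ph hG t (X y) := by
      rw [ph_comm, ph_of_adj hG hvt, hy]
      simp
    have hf : Fork hG X v t y z :=
      ⟨hxy.mono_left hvsub, hzx.symm.mono_left hvsub, hzy.symm⟩
    have hf' : Fork hG X t v x z' :=
      ⟨hxy'.symm.mono_left htsub, hzy'.symm.mono_left htsub, hzx'.symm⟩
    have h4 := (hδ _ _ _ _ (hf'.disjoint_ph hvt.ne' hf)).2
    rw [hx.1, Finset.sum_insert hx.2, hsum, forkWeight_eq hsymm hδ hvt hf hf', splitWeight]
    have := hsymm z z'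
    have := hsymm y x
    have := hsymm y z'
    linarith

theorem deltaW_forkWeight [Fintype V] [DecidableRel G.Adj]
    (hdeg : ∀ v : V, G.degree v ≤ 2 → v ∈ Set.range X) (hrefl : ∀ p, δ p p = 0) (x y : ι) :
    deltaW hG (forkWeight hG X δ) (X x) (X y) = δ x y := by
  rw [deltaW, ph_comm, sum_forkWeight_ph hsymm hδ hdeg hrefl x y _ (X y) y rfl] <;>
    simp [ph_self, hrefl]

end Symm

theorem fourPoint_of_distinct (hrefl : ∀ p, δ p p = 0) (hsymm : ∀ p q, δ p q = δ q p)
    (htriangle : ∀ p q r, δ p r ≤ δ p q + δ q r)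
    (h₄ : ∀ p q r s, p ≠ q → p ≠ r → p ≠ s → q ≠ r → q ≠ s → r ≠ s →
      ph hG (X p) (X q) ∩ ph hG (X r) (X s) = ∅ →
      δ p q + δ r s ≤ δ p r + δ q s ∧ δ p r + δ q s = δ p s + δ q r)
    (h₃ : ∀ p q r, p ≠ q → p ≠ r → q ≠ r →
      ph hG (X p) (X r) = ph hG (X p) (X q) ∪ ph hG (X q) (X r) → δ p q + δ q r = δ p r)
    (hXinj : Function.Injective X) : FourPoint hG X δ := by
  have hmid : ∀ p q s, Disjoint (ph hG (X p) (X q)) (ph hG (X p) (X s)) →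
      δ q p + δ p s = δ q s := by
    intro p q s hd
    by_cases hpq : p = q
    · subst hpq
      simp [hrefl]
    by_cases hps : p = s
    · subst hps
      simp [hrefl]
    by_cases hqs : q = s
    · subst hqs
      obtain ⟨t, -, ht⟩ := exists_adj_of_ne hG (hXinj.ne hpq)
      exact absurd ht (Finset.disjoint_left.1 hd ht)
    refine h₃ q p s (Ne.symm hpq) hqs hps ?_
    ext e
    rw [mem_ph_trans hG (X q) (X p), Finset.mem_union, ph_comm hG (X q)]
    have : e ∈ _ → e ∉ _ := fun h => Finset.disjoint_left.1 hd h
    tauto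
  intro p q r s hd
  by_cases hpq : p = q
  · subst hpq
    have := htriangle r p s
    have := hsymm r p
    have := hrefl p
    exact ⟨by linarith, by linarith⟩
  by_cases hrs : r = s
  · subst hrs
    have := htriangle p r q
    have := hsymm r q
    have := hrefl r
    exact ⟨by linarith, by linarith⟩
  have hn : ∀ a b, 0 ≤ δ a b := by
    intro a b
    have := htriangle a b a
    rw [hrefl, hsymm b a] at this
    linarith
  by_cases hpr : p = r
  · subst hpr
    have := hmid p q s hd
    have := hn p q
    have := hsymm p q
    have := hn p s
    have := hrefl p
    exact ⟨by linarith, by linarith⟩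
  by_cases hps : p = s
  · subst hps
    have := hmid p q r (by rwa [ph_comm hG (X p) (X r)])
    have := hn p q
    have := hsymm p q
    have := hsymm p r
    have := hn p r
    have := hrefl p
    exact ⟨by linarith, by linarith⟩
  by_cases hqr : q = r
  · subst hqr
    have := hmid q p s (by rwa [ph_comm hG (X q) (X p)])
    have := hrefl q
    exact ⟨by linarith, by linarith⟩
  by_cases hqs : q = s
  · subst hqs
    have := hmid q p r (by rwa [ph_comm hG (X q) (X p), ph_comm hG (X q) (X r)])
    have := hsymm q r
    have := hrefl q
    exact ⟨by linarith, by linarith⟩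
  exact h₄ p q r s hpq hpr hps hqr hqs hrs (Finset.disjoint_iff_inter_eq_empty.1 hd)

end Weights

/-- Let `T` be a finite tree with observed nodes `X_1, …, X_m` containing
every vertex of degree at most two.  A pseudometric `δ` on the observed nodes is `T`-induced
(i.e. of the form `δ_w` for some nonnegative edge weight function `w`) if and only if
(1) for all four distinct indices with `ph(X_p,X_q) ∩ ph(X_r,X_s) = ∅` one has
`δ_pq + δ_rs ≤ δ_pr + δ_qs = δ_ps + δ_qr`, and (2) for all three distinct indices with
`ph(X_p,X_r) = ph(X_p,X_q) ∪ ph(X_q,X_r)` one has `δ_pq + δ_qr = δ_pr`. -/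
theorem stmt0 {V : Type*} [Fintype V] [DecidableEq V] {G : SimpleGraph V}
    [DecidableRel G.Adj] (hG : G.IsTree) {m : ℕ} (X : Fin m → V)
    (hXinj : Function.Injective X)
    (hdeg : ∀ v : V, G.degree v ≤ 2 → v ∈ Set.range X)
    (δ : Fin m → Fin m → ℝ)
    (hnonneg : ∀ p q, 0 ≤ δ p q)
    (hrefl : ∀ p, δ p p = 0)
    (hsymm : ∀ p q, δ p q = δ q p)
    (htriangle : ∀ p q r, δ p r ≤ δ p q + δ q r) :
    (∃ w : Sym2 V → ℝ, (∀ e ∈ G.edgeSet, 0 ≤ w e) ∧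
        ∀ p q, δ p q = deltaW hG w (X p) (X q)) ↔
      ((∀ p q r s : Fin m, p ≠ q → p ≠ r → p ≠ s → q ≠ r → q ≠ s → r ≠ s →
          ph hG (X p) (X q) ∩ ph hG (X r) (X s) = ∅ →
          δ p q + δ r s ≤ δ p r + δ q s ∧ δ p r + δ q s = δ p s + δ q r) ∧
        (∀ p q r : Fin m, p ≠ q → p ≠ r → q ≠ r →
          ph hG (X p) (X r) = ph hG (X p) (X q) ∪ ph hG (X q) (X r) →
          δ p q + δ q r = δ p r)) := by
  constructor
  · rintro ⟨w, hw, hδ⟩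
    simp only [hδ]
    exact ⟨fun p q r s _ _ _ _ _ _ h =>
        deltaW_four_point hG hw (Finset.disjoint_iff_inter_eq_empty.2 h),
      fun p q r _ _ _ h => deltaW_add hG h⟩
  · rintro ⟨h₄, h₃⟩
    have hδ := fourPoint_of_distinct hrefl hsymm htriangle h₄ h₃ hXinj
    exact ⟨forkWeight hG X δ, fun e _ => forkWeight_nonneg hδ e,
      fun p q => (deltaW_forkWeight hsymm hδ hdeg hrefl p q).symm⟩
end

section
/- Let T = (V, E) be a finite tree and let p, q, r, s ∈ V be four distinct vertices. Then at least one of the three pairings has edge-disjoint connecting paths; that is, ph_T(π_p, π_q) ∩ ph_T(π_r, π_s) = ∅ for some permutation (π_p, π_q, π_r, π_s) of (p, q, r, s). -/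
open SimpleGraph Finset

/-- An edge traversed by a walk splits its length into the distances from the endpoints of the walk
to the endpoints of the edge. -/
theorem SimpleGraph.Walk.dist_add_dist_lt_length {V : Type*} {G : SimpleGraph V}
    (hG : G.Connected) {a b u v : V} (w : G.Walk u v) (h : s(a, b) ∈ w.edges) :
    G.dist u a + G.dist b v < w.length ∨ G.dist u b + G.dist a v < w.length := by
  induction w with
  | nil => simp at h
  | @cons u x v hux w ih =>
    rw [Walk.edges_cons, List.mem_cons] at h
    rw [Walk.length_cons]
    rcases h with h | h
    · have hw := G.dist_le w
      rcases Sym2.eq_iff.mp h with ⟨rfl, rfl⟩ | ⟨rfl, rfl⟩ <;> simp only [dist_self] <;> omega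
    · have hux' : G.dist u x = 1 := dist_eq_one_iff_adj.mpr hux
      have ha := hG.dist_triangle (u := u) (v := x) (w := a)
      have hb := hG.dist_triangle (u := u) (v := x) (w := b)
      have := ih h
      omega

theorem length_treePath {V : Type*} {G : SimpleGraph V} (hG : G.IsTree) (u v : V) :
    (treePath hG u v).length = G.dist u v := by
  obtain ⟨w, hw, hlen⟩ := hG.connected.exists_path_of_dist u v
  rw [← hlen, (hG.existsUnique_path u v).choose_spec.2 w hw, treePath]

/-- If the paths of one pairing share an edge, then another pairing has smaller total distance. -/
theorem dist_add_dist_lt_of_ph_inter_nonempty {V : Type*} [DecidableEq V] {G : SimpleGraph V}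
    (hG : G.IsTree) {p q r s : V} (h : (ph hG p q ∩ ph hG r s).Nonempty) :
    G.dist p r + G.dist q s < G.dist p q + G.dist r s ∨
      G.dist p s + G.dist q r < G.dist p q + G.dist r s := by
  obtain ⟨e, he⟩ := h
  induction e with | _ a b
  simp only [ph, Finset.mem_inter, List.mem_toFinset] at he
  have h₁ := Walk.dist_add_dist_lt_length hG.connected _ he.1
  have h₂ := Walk.dist_add_dist_lt_length hG.connected _ he.2
  rw [length_treePath] at h₁ h₂
  have triangle (x y c : V) : G.dist x y ≤ G.dist x c + G.dist y c := by
    simpa only [G.dist_comm (u := y)] using hG.connected.dist_triangle (u := x) (v := c) (w := y)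
  have := triangle p r a
  have := triangle p r b
  have := triangle q s a
  have := triangle q s b
  have := triangle p s a
  have := triangle p s b
  have := triangle q r a
  have := triangle q r b
  simp only [G.dist_comm (u := a), G.dist_comm (u := b)] at *
  omega

/-- For any four distinct vertices `p, q, r, s` of a finite tree, at least one
of the three pairings has edge-disjoint connecting paths. -/
theorem stmt6 {V : Type*} [Fintype V] [DecidableEq V] {G : SimpleGraph V} (hG : G.IsTree)
    (p q r s : V) (hpq : p ≠ q) (hpr : p ≠ r) (hps : p ≠ s)
    (hqr : q ≠ r) (hqs : q ≠ s) (hrs : r ≠ s) :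
    ph hG p q ∩ ph hG r s = ∅ ∨ ph hG p r ∩ ph hG q s = ∅ ∨ ph hG p s ∩ ph hG q r = ∅ := by
  by_contra! h
  obtain ⟨h₁, h₂, h₃⟩ := h
  have := dist_add_dist_lt_of_ph_inter_nonempty hG h₁
  have := dist_add_dist_lt_of_ph_inter_nonempty hG h₂
  have := dist_add_dist_lt_of_ph_inter_nonempty hG h₃
  simp only [G.dist_comm (u := r) (v := q), G.dist_comm (u := s) (v := q),
    G.dist_comm (u := s) (v := r)] at *
  omega
end
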